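/- Fix an integer k ≥ 1 and ζ : Fin k → ℂ × ℂ with Σ_i ζ i = (0,0). Define s : ℝ⁴ → ℂ by s(x,y,z,t) = Π_{i=1}^{k} θ(z+ix+(ζ i).1, y+i)·θ(y+it+(ζ i).2, i). Then s satisfies, for all (x,y,z,t) ∈ ℝ⁴: s(x+1, y, z+y, t) = exp(−2πi k (z+ix))·s(x,y,z,t); s(x, y+1, z, t) = s(x,y,z,t); s(x, y, z+1, t) = s(x,y,z,t); and s(x, y, z, t+1) = exp(−2πi k (y+it))·s(x,y,z,t). That is, s is a theta function of degree k on the Kodaira–Thurston manifold. -/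

import Mathlib

open Complex

/-- The theta function `θ(z,τ) = Σ_{n∈ℤ} exp(2πi n z + π i n(n−1) τ)`. -/
noncomputable def theta (z τ : ℂ) : ℂ :=
  ∑' n : ℤ, Complex.exp (2 * Real.pi * Complex.I * n * z +
    Real.pi * Complex.I * n * (n - 1) * τ)

/-- The product `s(x,y,z,t) = Π_i θ(z+ix+(ζ i)₁, y+i)·θ(y+it+(ζ i)₂, i)`. -/
noncomputable def sProd (k : ℕ) (ζ : Fin k → ℂ × ℂ) (x y z t : ℝ) : ℂ :=
  ∏ i, theta ((z : ℂ) + Complex.I * x + (ζ i).1) ((y : ℂ) + Complex.I) *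
    theta ((y : ℂ) + Complex.I * t + (ζ i).2) Complex.I

theorem theta_add_one_left (z τ : ℂ) : theta (z + 1) τ = theta z τ := by
  refine tsum_congr fun n => Complex.exp_eq_exp_iff_exists_int.mpr ⟨n, ?_⟩
  ring

theorem theta_add_one_right (z τ : ℂ) : theta z (τ + 1) = theta z τ := by
  refine tsum_congr fun n => ?_
  obtain ⟨m, hm⟩ := Int.even_mul_pred_self n
  have hm' : (n : ℂ) * (n - 1) = m + m := by exact_mod_cast hm
  refine Complex.exp_eq_exp_iff_exists_int.mpr ⟨m, ?_⟩
  linear_combination (Real.pi * Complex.I) * hm'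

theorem theta_add_tau (z τ : ℂ) :
    theta (z + τ) τ = Complex.exp (-(2 * Real.pi * Complex.I * z)) * theta z τ := by
  unfold theta
  symm
  rw [← tsum_mul_left, ← (Equiv.addRight (1 : ℤ)).tsum_eq]
  refine tsum_congr fun n => ?_
  rw [← Complex.exp_add, Equiv.coe_addRight]
  push_cast
  ring_nf

theorem prod_exp_neg_add_of_sum_eq_zero {k : ℕ} (c w : ℂ) (v : Fin k → ℂ)
    (hv : ∑ i, v i = 0) :
    ∏ i, Complex.exp (-(c * (w + v i))) = Complex.exp (-(c * k * w)) := by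
  rw [← Complex.exp_sum, Finset.sum_neg_distrib, ← Finset.mul_sum, Finset.sum_add_distrib, hv]
  simp [mul_assoc]

/-- If `Σ ζ i = 0` in `ℂ²`, then `s` is a theta function of degree `k` on the
Kodaira–Thurston manifold: it satisfies the degree-`k` quasi-periodicity conditions
under the generators of the group `Γ`. -/
theorem sProd_degree_k_quasiperiodic (k : ℕ) (hk : 1 ≤ k) (ζ : Fin k → ℂ × ℂ)
    (hζ : ∑ i, ζ i = (0, 0)) (x y z t : ℝ) :
    sProd k ζ (x + 1) y (z + y) t =
      Complex.exp (-(2 * Real.pi * Complex.I * k * ((z : ℂ) + Complex.I * x))) *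
        sProd k ζ x y z t ∧
    sProd k ζ x (y + 1) z t = sProd k ζ x y z t ∧
    sProd k ζ x y (z + 1) t = sProd k ζ x y z t ∧
    sProd k ζ x y z (t + 1) =
      Complex.exp (-(2 * Real.pi * Complex.I * k * ((y : ℂ) + Complex.I * t))) *
        sProd k ζ x y z t := by
  have h₁ : ∑ i, (ζ i).1 = 0 := by simpa [Prod.fst_sum] using congrArg Prod.fst hζ
  have h₂ : ∑ i, (ζ i).2 = 0 := by simpa [Prod.snd_sum] using congrArg Prod.snd hζ
  unfold sProd
  refine ⟨?_, ?_, ?_, ?_⟩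
  · rw [← prod_exp_neg_add_of_sum_eq_zero _ _ _ h₁, ← Finset.prod_mul_distrib]
    refine Finset.prod_congr rfl fun i _ => ?_
    rw [← mul_assoc, ← theta_add_tau]
    push_cast
    ring_nf
  · refine Finset.prod_congr rfl fun i _ => ?_
    rw [← theta_add_one_right _ ((y : ℂ) + Complex.I),
      ← theta_add_one_left ((y : ℂ) + Complex.I * t + (ζ i).2)]
    push_cast
    ring_nf
  · refine Finset.prod_congr rfl fun i _ => ?_
    rw [← theta_add_one_left ((z : ℂ) + Complex.I * x + (ζ i).1)]
    push_cast
    ring_nf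
  · rw [← prod_exp_neg_add_of_sum_eq_zero _ _ _ h₂, ← Finset.prod_mul_distrib]
    refine Finset.prod_congr rfl fun i _ => ?_
    rw [mul_left_comm, ← theta_add_tau]
    push_cast
    ring_nf
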